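/- Let t > 0 and S > 0. Let p_t(s) = (2πt)^{-1/2} exp(-s²/(2t)) be the density of the normal distribution N(0,t), and let q_{t,S} be the truncated Gaussian density q_{t,S}(s) = exp(-s²/(2t)) / (∫_{-S}^{S} exp(-u²/(2t)) du) for |s| ≤ S and q_{t,S}(s) = 0 for |s| > S. Then the total variation distance (1/2) ∫_ℝ |p_t(s) - q_{t,S}(s)| ds is at most √(2/π) · (√t / S) · exp(-S²/(2t)). -/

import Mathlib

open MeasureTheory

/-- The density of the normal distribution `N(0, t)`. -/
noncomputable def gaussPdf (t s : ℝ) : ℝ :=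
  (Real.sqrt (2 * Real.pi * t))⁻¹ * Real.exp (-s ^ 2 / (2 * t))

/-- The density of `N(0, t)` truncated to `[-S, S]`. -/
noncomputable def truncGaussPdf (t S s : ℝ) : ℝ :=
  if |s| ≤ S then
    Real.exp (-s ^ 2 / (2 * t)) / ∫ u in (-S)..S, Real.exp (-u ^ 2 / (2 * t))
  else 0

theorem integrable_exp_neg_sq_div {t : ℝ} (ht : 0 < t) :
    Integrable fun s : ℝ => Real.exp (-s ^ 2 / (2 * t)) := by
  refine (integrable_exp_neg_mul_sq (b := (2 * t)⁻¹) (by positivity)).congr (.of_forall fun s => ?_)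
  simp only [div_eq_mul_inv]
  ring_nf

theorem integral_exp_neg_sq_div (t : ℝ) :
    ∫ s : ℝ, Real.exp (-s ^ 2 / (2 * t)) = Real.sqrt (2 * Real.pi * t) := by
  have h := integral_gaussian (2 * t)⁻¹
  rw [div_inv_eq_mul] at h
  rw [show 2 * Real.pi * t = Real.pi * (2 * t) by ring, ← h]
  congr 1 with s
  congr 1
  simp only [div_eq_mul_inv]
  ring

theorem integral_Ioi_mul_exp_neg_sq_div {t : ℝ} (ht : 0 < t) (S : ℝ) :
    IntegrableOn (fun s : ℝ => s * Real.exp (-s ^ 2 / (2 * t))) (Set.Ioi S) ∧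
      ∫ s in Set.Ioi S, s * Real.exp (-s ^ 2 / (2 * t)) = t * Real.exp (-S ^ 2 / (2 * t)) := by
  have hint : Integrable fun s : ℝ => s * Real.exp (-s ^ 2 / (2 * t)) := by
    refine (integrable_mul_exp_neg_mul_sq (b := (2 * t)⁻¹) (by positivity)).congr
      (.of_forall fun s => ?_)
    simp only [div_eq_mul_inv]
    ring_nf
  refine ⟨hint.integrableOn, ?_⟩
  have hderiv : ∀ x ∈ Set.Ici S, HasDerivAt (fun s : ℝ => -t * Real.exp (-s ^ 2 / (2 * t)))
      (x * Real.exp (-x ^ 2 / (2 * t))) x := by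
    intro x _
    have h : HasDerivAt (fun s : ℝ => -s ^ 2 / (2 * t)) (-(2 * x) / (2 * t)) x := by
      simpa using (hasDerivAt_pow 2 x).fun_neg.div_const (2 * t)
    refine (h.exp.const_mul (-t)).congr_deriv ?_
    field_simp
  have hlim : Filter.Tendsto (fun s : ℝ => -t * Real.exp (-s ^ 2 / (2 * t)))
      Filter.atTop (nhds 0) := by
    have h : Filter.Tendsto (fun s : ℝ => -s ^ 2 / (2 * t)) Filter.atTop Filter.atBot :=
      (Filter.tendsto_neg_atTop_atBot.comp
        (Filter.tendsto_pow_atTop two_ne_zero)).atBot_div_const (by positivity)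
    simpa using (Real.tendsto_exp_atBot.comp h).const_mul (-t)
  rw [integral_Ioi_of_hasDerivAt_of_tendsto' hderiv hint.integrableOn hlim]
  ring

theorem setIntegral_compl_Icc_exp_neg_sq_div_le {t S : ℝ} (ht : 0 < t) (hS : 0 < S) :
    ∫ s in (Set.Icc (-S) S)ᶜ, Real.exp (-s ^ 2 / (2 * t))
      ≤ 2 * (t / S * Real.exp (-S ^ 2 / (2 * t))) := by
  have hfold : ∫ s in (Set.Icc (-S) S)ᶜ, Real.exp (-s ^ 2 / (2 * t))
      = 2 * ∫ s in Set.Ioi S, Real.exp (-s ^ 2 / (2 * t)) := by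
    have h := integral_comp_abs
      (f := (Set.Ioi S).indicator fun s : ℝ => Real.exp (-s ^ 2 / (2 * t)))
    rw [setIntegral_indicator measurableSet_Ioi, Set.Ioi_inter_Ioi, sup_of_le_right hS.le] at h
    rw [← h, ← integral_indicator measurableSet_Icc.compl]
    congr 1 with s
    simp only [Set.indicator_apply, Set.mem_compl_iff, Set.mem_Icc, ← abs_le, not_le, Set.mem_Ioi,
      sq_abs]
  obtain ⟨hint, heq⟩ := integral_Ioi_mul_exp_neg_sq_div ht S
  rw [hfold]
  gcongr
  calc ∫ s in Set.Ioi S, Real.exp (-s ^ 2 / (2 * t))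
      ≤ ∫ s in Set.Ioi S, S⁻¹ * (s * Real.exp (-s ^ 2 / (2 * t))) := by
        refine setIntegral_mono_on (integrable_exp_neg_sq_div ht).integrableOn
          (hint.const_mul _) measurableSet_Ioi fun s hs => ?_
        rw [← mul_assoc]
        refine le_mul_of_one_le_left (Real.exp_pos _).le ?_
        rw [inv_mul_eq_div, one_le_div hS]
        exact (Set.mem_Ioi.mp hs).le
    _ = t / S * Real.exp (-S ^ 2 / (2 * t)) := by
        rw [integral_const_mul, heq]
        ring

theorem integral_abs_gaussPdf_sub_truncGaussPdf {t S : ℝ} (ht : 0 < t) (hS : 0 < S) :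
    ∫ s : ℝ, |gaussPdf t s - truncGaussPdf t S s|
      = 2 * ((Real.sqrt (2 * Real.pi * t))⁻¹ *
          ∫ s in (Set.Icc (-S) S)ᶜ, Real.exp (-s ^ 2 / (2 * t))) := by
  have hg := integrable_exp_neg_sq_div ht
  have hpi := Real.pi_pos
  have hG : 0 < Real.sqrt (2 * Real.pi * t) := by positivity
  set Z := ∫ u in (-S)..S, Real.exp (-u ^ 2 / (2 * t)) with hZ
  have hZpos : 0 < Z := intervalIntegral.intervalIntegral_pos_of_pos
    hg.intervalIntegrable (fun _ => Real.exp_pos _) (by linarith)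
  have hZset : ∫ u in Set.Icc (-S) S, Real.exp (-u ^ 2 / (2 * t)) = Z := by
    rw [hZ, intervalIntegral.integral_of_le (by linarith), integral_Icc_eq_integral_Ioc]
  have hadd := integral_add_compl (measurableSet_Icc (a := -S) (b := S)) hg
  rw [hZset, integral_exp_neg_sq_div] at hadd
  have hT : 0 ≤ ∫ s in (Set.Icc (-S) S)ᶜ, Real.exp (-s ^ 2 / (2 * t)) :=
    integral_nonneg fun _ => (Real.exp_pos _).le
  set T := ∫ s in (Set.Icc (-S) S)ᶜ, Real.exp (-s ^ 2 / (2 * t))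
  set G := Real.sqrt (2 * Real.pi * t) with hGdef
  have hinv : G⁻¹ ≤ Z⁻¹ := inv_anti₀ hZpos (by linarith)
  have hin : Set.EqOn (fun s => |gaussPdf t s - truncGaussPdf t S s|)
      (fun s => (Z⁻¹ - G⁻¹) * Real.exp (-s ^ 2 / (2 * t))) (Set.Icc (-S) S) := by
    intro s hs
    simp only [gaussPdf, truncGaussPdf, if_pos (abs_le.mpr hs), ← hZ, ← hGdef]
    rw [div_eq_inv_mul (Real.exp _), ← sub_mul, abs_mul, abs_of_pos (Real.exp_pos _), abs_sub_comm,
      abs_of_nonneg (sub_nonneg.mpr hinv)]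
  have hout : Set.EqOn (fun s => |gaussPdf t s - truncGaussPdf t S s|)
      (fun s => G⁻¹ * Real.exp (-s ^ 2 / (2 * t))) (Set.Icc (-S) S)ᶜ := by
    intro s hs
    have hs' : ¬ |s| ≤ S := fun h => hs (abs_le.mp h)
    simp only [gaussPdf, truncGaussPdf, if_neg hs', ← hGdef, sub_zero]
    exact abs_of_pos (by positivity)
  have hint : Integrable fun s => |gaussPdf t s - truncGaussPdf t S s| := by
    rw [← integrableOn_univ, ← Set.union_compl_self (Set.Icc (-S) S)]
    exact ((hg.const_mul _).integrableOn.congr_fun hin.symm measurableSet_Icc).union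
      ((hg.const_mul _).integrableOn.congr_fun hout.symm measurableSet_Icc.compl)
  rw [← integral_add_compl (measurableSet_Icc (a := -S) (b := S)) hint,
    setIntegral_congr_fun measurableSet_Icc hin,
    setIntegral_congr_fun measurableSet_Icc.compl hout, integral_const_mul, integral_const_mul,
    hZset]
  have hTG : T = G - Z := by linarith
  change (Z⁻¹ - G⁻¹) * Z + G⁻¹ * T = _
  rw [hTG]
  field_simp
  ring

/-- the total variation distance between `N(0,t)` and its truncation to
`[-S, S]` is at most `√(2/π) ⬝ (√t / S) ⬝ exp(-S²/(2t))`. -/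
theorem tv_gauss_trunc_le (t S : ℝ) (ht : 0 < t) (hS : 0 < S) :
    (1 / 2) * ∫ s : ℝ, |gaussPdf t s - truncGaussPdf t S s|
      ≤ Real.sqrt (2 / Real.pi) * (Real.sqrt t / S) * Real.exp (-S ^ 2 / (2 * t)) := by
  have hpi := Real.pi_pos
  have hG : 0 < Real.sqrt (2 * Real.pi * t) := by positivity
  have hconst : (Real.sqrt (2 * Real.pi * t))⁻¹ * (2 * t)
      = Real.sqrt (2 / Real.pi) * Real.sqrt t := by
    rw [inv_mul_eq_iff_eq_mul₀ hG.ne', ← Real.sqrt_mul (by positivity),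
      ← Real.sqrt_mul (by positivity), eq_comm, Real.sqrt_eq_iff_mul_self_eq_of_pos (by positivity)]
    field_simp
  rw [integral_abs_gaussPdf_sub_truncGaussPdf ht hS]
  calc (1 / 2) * (2 * ((Real.sqrt (2 * Real.pi * t))⁻¹ *
          ∫ s in (Set.Icc (-S) S)ᶜ, Real.exp (-s ^ 2 / (2 * t))))
      = (Real.sqrt (2 * Real.pi * t))⁻¹ *
          ∫ s in (Set.Icc (-S) S)ᶜ, Real.exp (-s ^ 2 / (2 * t)) := by ring
    _ ≤ (Real.sqrt (2 * Real.pi * t))⁻¹ * (2 * (t / S * Real.exp (-S ^ 2 / (2 * t)))) := by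
        gcongr
        exact setIntegral_compl_Icc_exp_neg_sq_div_le ht hS
    _ = (Real.sqrt (2 * Real.pi * t))⁻¹ * (2 * t) / S * Real.exp (-S ^ 2 / (2 * t)) := by ring
    _ = Real.sqrt (2 / Real.pi) * (Real.sqrt t / S) * Real.exp (-S ^ 2 / (2 * t)) := by
        rw [hconst]
        ring
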